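/- (Gauss–Kuzmin-type equation) Let μ be a non-atomic Borel probability measure on [0,1] and define F_{m,n}(x) = μ({t ∈ [0,1] : τ_mⁿ(t) ≤ x}) for n ∈ ℕ and x ∈ [0,1] (with τ_m⁰ the identity). Then for all x ∈ [0,1] and n ∈ ℕ, F_{m,n+1}(x) = Σ_{i=0}^{∞} [ F_{m,n}(αⁱ) − F_{m,n}( αⁱ/(1+(m−1)x) ) ], where α = 1/m. -/

import Mathlib

open MeasureTheory Set

/-- The Chan transformation `τ_m : [0,1] → [0,1]`: `τ_m(0) = 0` and, for
`x ∈ (m^{-(i+1)}, m^{-i}]` (equivalently `i = ⌊-log_m x⌋`),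
`τ_m(x) = (1/(m-1)) (1/(mⁱ x) - 1)`. -/
noncomputable def chanTau (m : ℕ) (x : ℝ) : ℝ :=
  if x = 0 then 0
  else (1 / ((m : ℝ) - 1)) * (1 / ((m : ℝ) ^ ⌊-Real.logb m x⌋ * x) - 1)


theorem chanTau_eq_of_mem_Ioc {m : ℕ} (hm : 2 ≤ m) {s : ℝ} {i : ℕ}
    (hs : s ∈ Ioc (((m : ℝ)⁻¹) ^ (i + 1)) (((m : ℝ)⁻¹) ^ i)) :
    chanTau m s = (1 / ((m : ℝ) - 1)) * (1 / ((m : ℝ) ^ i * s) - 1) := by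
  have hm1 : (1 : ℝ) < m := by exact_mod_cast hm
  have hm0 : (0 : ℝ) < m := by linarith
  have hs0 : 0 < s := lt_trans (by positivity) hs.1
  have hlog (k : ℕ) : Real.logb m (((m : ℝ)⁻¹) ^ k) = -(k : ℝ) := by
    rw [Real.logb_pow, Real.logb_inv, Real.logb_self_eq_one hm1]
    ring
  have hfloor : ⌊-Real.logb m s⌋ = (i : ℤ) := by
    have h1 := Real.logb_lt_logb hm1 (by positivity) hs.1
    have h2 := Real.logb_le_logb_of_le hm1 hs0 hs.2
    rw [hlog] at h1 h2
    rw [Int.floor_eq_iff]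
    push_cast at h1 ⊢
    constructor <;> linarith
  rw [chanTau, if_neg hs0.ne', hfloor, zpow_natCast]

theorem exists_mem_Ioc_inv_pow {m : ℕ} (hm : 2 ≤ m) {s : ℝ} (hs0 : 0 < s) (hs1 : s ≤ 1) :
    ∃ i : ℕ, s ∈ Ioc (((m : ℝ)⁻¹) ^ (i + 1)) (((m : ℝ)⁻¹) ^ i) := by
  have hm1 : (1 : ℝ) < m := by exact_mod_cast hm
  exact exists_nat_pow_near_of_lt_one hs0 hs1 (by positivity) (inv_lt_one_of_one_lt₀ hm1)

theorem chanTau_le_iff {m : ℕ} (hm : 2 ≤ m) {s x : ℝ} {i : ℕ} (hx : 0 ≤ x)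
    (hs : s ∈ Ioc (((m : ℝ)⁻¹) ^ (i + 1)) (((m : ℝ)⁻¹) ^ i)) :
    chanTau m s ≤ x ↔ ((m : ℝ)⁻¹) ^ i / (1 + ((m : ℝ) - 1) * x) ≤ s := by
  have hm1 : (1 : ℝ) < m := by exact_mod_cast hm
  have hm0 : (0 : ℝ) < m := by linarith
  have hs0 : 0 < s := lt_trans (by positivity) hs.1
  have hp : (0 : ℝ) < (m : ℝ) - 1 := by linarith
  have hd : 0 < 1 + ((m : ℝ) - 1) * x := by positivity
  have hmi : (0 : ℝ) < (m : ℝ) ^ i := by positivity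
  rw [chanTau_eq_of_mem_Ioc hm hs, one_div_mul_eq_div, div_le_iff₀ hp, sub_le_iff_le_add,
    div_le_iff₀ (by positivity), div_le_iff₀ hd, inv_pow, inv_le_iff_one_le_mul₀ hmi]
  constructor <;> intro h <;> linarith

theorem chanTau_mem_Icc {m : ℕ} (hm : 2 ≤ m) {s : ℝ} (hs : s ∈ Icc (0 : ℝ) 1) :
    chanTau m s ∈ Icc (0 : ℝ) 1 := by
  have hm1 : (1 : ℝ) < m := by exact_mod_cast hm
  have hm0 : (0 : ℝ) < m := by linarith
  rcases hs.1.eq_or_lt with rfl | hs0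
  · simp [chanTau]
  obtain ⟨i, hi⟩ := exists_mem_Ioc_inv_pow hm hs0 hs.2
  refine ⟨?_, (chanTau_le_iff hm zero_le_one hi).2 ?_⟩
  · have hmi : (0 : ℝ) < (m : ℝ) ^ i := by positivity
    have h : (m : ℝ) ^ i * s ≤ 1 := by
      have := mul_le_mul_of_nonneg_left hi.2 hmi.le
      rwa [inv_pow, mul_inv_cancel₀ hmi.ne'] at this
    rw [chanTau_eq_of_mem_Ioc hm hi]
    have h1 : 1 ≤ 1 / ((m : ℝ) ^ i * s) := (one_le_div (by positivity)).2 h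
    exact mul_nonneg (one_div_nonneg.2 (by linarith)) (by linarith)
  · have h := hi.1.le
    rw [pow_succ, ← div_eq_mul_inv] at h
    rwa [mul_one, add_sub_cancel]

theorem measurable_chanTau (m : ℕ) : Measurable (chanTau m) := by
  have hpow : Measurable fun x : ℝ => (m : ℝ) ^ ⌊-Real.logb m x⌋ :=
    (measurable_from_top (f := fun k : ℤ => (m : ℝ) ^ k)).comp
      (Int.measurable_floor.comp ((Real.measurable_log.div_const _).neg))
  exact Measurable.ite (measurableSet_singleton 0) measurable_const
    ((((hpow.mul measurable_id).const_div 1).sub_const 1).const_mul _)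

theorem countable_chanTau_preimage_singleton {m : ℕ} (hm : 2 ≤ m) (c : ℝ) :
    (chanTau m ⁻¹' {c}).Countable := by
  have hm1 : (1 : ℝ) < m := by exact_mod_cast hm
  have hm0 : (m : ℝ) ≠ 0 := by linarith
  refine ((countable_range fun k : ℤ => ((m : ℝ) ^ k)⁻¹ * (1 + ((m : ℝ) - 1) * c)⁻¹).insert
    0).mono ?_
  intro s hs
  by_cases hs0 : s = 0
  · exact Or.inl hs0
  refine Or.inr ⟨⌊-Real.logb m s⌋, ?_⟩
  have hs' : chanTau m s = c := hs
  rw [chanTau, if_neg hs0] at hs'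
  have hp : (m : ℝ) - 1 ≠ 0 := by linarith
  have hk : (m : ℝ) ^ ⌊-Real.logb m s⌋ ≠ 0 := zpow_ne_zero _ hm0
  simp only
  rw [← hs']
  generalize (m : ℝ) ^ ⌊-Real.logb m s⌋ = K at hk
  field_simp
  simp

theorem nullSingletonClass_map_chanTau {m : ℕ} (hm : 2 ≤ m) (ν : Measure ℝ)
    [NullSingletonClass ν] :
    NullSingletonClass (ν.map (chanTau m)) where
  measure_singleton c := by
    rw [Measure.map_apply (measurable_chanTau m) (measurableSet_singleton c)]
    exact (countable_chanTau_preimage_singleton hm c).measure_zero ν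

theorem nullSingletonClass_map_chanTau_iterate {m : ℕ} (hm : 2 ≤ m) (ν : Measure ℝ)
    [NullSingletonClass ν] (n : ℕ) :
    NullSingletonClass (ν.map (chanTau m)^[n]) := by
  induction n with
  | zero => simpa using ‹NullSingletonClass ν›
  | succ n ih =>
    rw [Function.iterate_succ', ← Measure.map_map (measurable_chanTau m)
      ((measurable_chanTau m).iterate n)]
    exact nullSingletonClass_map_chanTau hm _

theorem chanTau_iterate_mem_Icc {m : ℕ} (hm : 2 ≤ m) (n : ℕ) {s : ℝ} (hs : s ∈ Icc (0 : ℝ) 1) :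
    (chanTau m)^[n] s ∈ Icc (0 : ℝ) 1 :=
  (show MapsTo (chanTau m) (Icc 0 1) (Icc 0 1) from fun _ => chanTau_mem_Icc hm).iterate n hs

/-- The Gauss–Kuzmin equation for a single step, expressed through the law of the current
iterate. -/
theorem measureReal_chanTau_le {m : ℕ} (hm : 2 ≤ m) (ν : Measure ℝ) [IsFiniteMeasure ν]
    [NullSingletonClass ν] (hν : ∀ᵐ s ∂ν, s ∈ Icc (0 : ℝ) 1) {x : ℝ} (hx : x ∈ Icc (0 : ℝ) 1) :
    ν.real {s | chanTau m s ≤ x} =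
      ∑' i : ℕ, (ν.real (Iic (((m : ℝ)⁻¹) ^ i)) -
        ν.real (Iic (((m : ℝ)⁻¹) ^ i / (1 + ((m : ℝ) - 1) * x)))) := by
  have hm1 : (1 : ℝ) < m := by exact_mod_cast hm
  have hm0 : (0 : ℝ) < m := by linarith
  have hp : (0 : ℝ) < (m : ℝ) - 1 := by linarith
  have hd1 : 1 ≤ 1 + ((m : ℝ) - 1) * x := le_add_of_nonneg_right (mul_nonneg hp.le hx.1)
  have hdm : 1 + ((m : ℝ) - 1) * x ≤ m := by nlinarith [hx.2]
  have hd0 : 0 < 1 + ((m : ℝ) - 1) * x := by linarith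
  set a : ℕ → ℝ := fun i => ((m : ℝ)⁻¹) ^ i with ha
  set b : ℕ → ℝ := fun i => ((m : ℝ)⁻¹) ^ i / (1 + ((m : ℝ) - 1) * x) with hb
  have hanti : Antitone a :=
    pow_right_anti₀ (by positivity) (inv_le_one_of_one_le₀ hm1.le)
  have hba (i : ℕ) : b i ≤ a i := div_le_self (by positivity) hd1
  have hab (i : ℕ) : a (i + 1) ≤ b i := by
    simp only [ha, hb]
    rw [pow_succ, ← div_eq_mul_inv]
    exact div_le_div_of_nonneg_left (by positivity) hd0 hdm
  have hsub (i : ℕ) : Ioc (b i) (a i) ⊆ Ioc (a (i + 1)) (a i) := Ioc_subset_Ioc_left (hab i)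
  have hdisj : Pairwise (Function.onFun Disjoint fun i => Ioc (b i) (a i)) := fun i j hij =>
    (hanti.pairwise_disjoint_on_Ioc_succ hij).mono (hsub i) (hsub j)
  have hae : {s | chanTau m s ≤ x} =ᵐ[ν] ⋃ i, Ioc (b i) (a i) := by
    have hcount : ((range b).insert 0).Countable := (countable_range b).insert 0
    filter_upwards [hν, hcount.ae_notMem ν] with s hs hsb
    have hs0 : 0 < s := hs.1.lt_of_ne fun h => hsb (Or.inl h.symm)
    have hne (i : ℕ) : b i ≠ s := fun h => hsb (Or.inr ⟨i, h⟩)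
    refine propext (show chanTau m s ≤ x ↔ s ∈ ⋃ i, Ioc (b i) (a i) from ?_)
    rw [mem_iUnion]
    constructor
    · intro h
      obtain ⟨i, hi⟩ := exists_mem_Ioc_inv_pow hm hs0 hs.2
      exact ⟨i, lt_of_le_of_ne ((chanTau_le_iff hm hx.1 hi).1 h) (hne i), hi.2⟩
    · rintro ⟨i, hi⟩
      exact (chanTau_le_iff hm hx.1 (hsub i hi)).2 hi.1.le
  have hIoc (i : ℕ) : ν.real (Ioc (b i) (a i)) = ν.real (Iic (a i)) - ν.real (Iic (b i)) := by
    rw [← Iic_sdiff_Iic, measureReal_sdiff (Iic_subset_Iic.2 (hba i)) measurableSet_Iic]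
  rw [measureReal_congr hae, measureReal_def, measure_iUnion hdisj fun i => measurableSet_Ioc,
    ENNReal.tsum_toReal_eq fun i => measure_ne_top ν _]
  exact tsum_congr hIoc

/-- Gauss–Kuzmin-type equation: if `μ` is a non-atomic Borel probability
measure on `[0,1]` and `F_n(x) = μ{t ∈ [0,1] : τ_mⁿ(t) ≤ x}`, then for all `x ∈ [0,1]`
and `n ∈ ℕ`, `F_{n+1}(x) = Σ_i ( F_n(αⁱ) − F_n(αⁱ/(1+(m-1)x)) )` with `α = 1/m`. -/
theorem chan_gauss_kuzmin_equation (m : ℕ) (hm : 2 ≤ m)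
    (μ : MeasureTheory.Measure ℝ) [MeasureTheory.IsProbabilityMeasure μ]
    (hsupp : μ (Set.Icc (0 : ℝ) 1)ᶜ = 0)
    (hatom : ∀ x : ℝ, μ {x} = 0)
    (F : ℕ → ℝ → ℝ)
    (hF : ∀ n : ℕ, ∀ x : ℝ,
      F n x = (μ {t | t ∈ Set.Icc (0 : ℝ) 1 ∧ (chanTau m)^[n] t ≤ x}).toReal) :
    ∀ x ∈ Set.Icc (0 : ℝ) 1, ∀ n : ℕ,
      F (n + 1) x =
        ∑' i : ℕ,
          (F n (((m : ℝ)⁻¹) ^ i) - F n (((m : ℝ)⁻¹) ^ i / (1 + ((m : ℝ) - 1) * x))) := by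
  intro x hx n
  have : NullSingletonClass μ := ⟨hatom⟩
  have hmeas (k : ℕ) : Measurable (chanTau m)^[k] := (measurable_chanTau m).iterate k
  have hμ : ∀ᵐ t ∂μ, t ∈ Icc (0 : ℝ) 1 := hsupp
  have hFμ (k : ℕ) (y : ℝ) : F k y = μ.real {t | (chanTau m)^[k] t ≤ y} := by
    rw [hF, ← measureReal_def]
    refine measureReal_congr ?_
    filter_upwards [hμ] with t ht
    exact propext (and_iff_right ht)
  have hFν (y : ℝ) : F n y = (μ.map (chanTau m)^[n]).real (Iic y) := by
    rw [hFμ, map_measureReal_apply (hmeas n) measurableSet_Iic]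
    rfl
  have hsucc : F (n + 1) x = (μ.map (chanTau m)^[n]).real {s | chanTau m s ≤ x} := by
    rw [hFμ, map_measureReal_apply (hmeas n)
      (measurableSet_le (measurable_chanTau m) measurable_const), Function.iterate_succ']
    rfl
  have := nullSingletonClass_map_chanTau_iterate hm μ n
  have hν : ∀ᵐ s ∂(μ.map (chanTau m)^[n]), s ∈ Icc (0 : ℝ) 1 := by
    refine (ae_map_iff (hmeas n).aemeasurable measurableSet_Icc).2 ?_
    filter_upwards [hμ] with t ht using chanTau_iterate_mem_Icc hm n ht
  simp only [hsucc, hFν]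
  exact measureReal_chanTau_le hm _ hν hx
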